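/- Let 0 ≤ m ≤ n and m+1 ≤ |k| ≤ n be integers. For each 1 ≤ i ≤ n−|k|+1, the function ψ_{k,i} belongs to Π_n^m, has unit norm, and is an eigenfunction of the space-frequency operator: P_n^m M P_n^m ψ_{k,i} = x_{|k|,i} ψ_{k,i}. Moreover, for all (θ,φ) with cosθ ≠ x_{|k|,i}, ψ_{k,i}(θ,φ) = κ_{k,i} · b_{n−|k|+1}^{(|k|)} · p_{n−|k|}^{(|k|)}(x_{|k|,i}) · sin^{|k|}θ · p_{n−|k|+1}^{(|k|)}(cosθ) · e^{ikφ} / (cosθ − x_{|k|,i}). -/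

import Mathlib

open MeasureTheory Finset

noncomputable section

namespace SFT

/-- The recurrence coefficients `b_l^{(α)}` of the orthonormal ultraspherical polynomials. -/
def b (α : ℝ) : ℕ → ℝ
  | 0 => Real.sqrt (Real.sqrt Real.pi * Real.Gamma (α + 1) / (2 * Real.Gamma (α + 3 / 2)))
  | l + 1 => Real.sqrt ((((l : ℝ) + 1) * (((l : ℝ) + 1) + 2 * α)) /
      ((2 * ((l : ℝ) + 1) + 2 * α + 1) * (2 * ((l : ℝ) + 1) + 2 * α - 1)))

/-- The associated ultraspherical polynomials: `pA α m l x = p_l^{(α)}(x, m)`.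
For `m = 0` these are the orthonormal ultraspherical polynomials `p_l^{(α)}(x)`. -/
def pA (α : ℝ) (m : ℕ) : ℕ → ℝ → ℝ
  | 0, _ => 1 / b α m
  | 1, x => x * (1 / b α m) / b α (m + 1)
  | l + 2, x => (x * pA α m (l + 1) x - b α (m + l + 1) * pA α m l x) / b α (m + l + 2)

/-- The orthonormal ultraspherical polynomials `p_l^{(α)}(x)`. -/
def p (α : ℝ) (l : ℕ) (x : ℝ) : ℝ := pA α 0 l x

/-- Ultraspherical polynomials with integer index; in particular `p_{-1}^{(α)} = 0`. -/
def pZ (α : ℝ) (l : ℤ) (x : ℝ) : ℝ := if 0 ≤ l then p α l.toNat x else 0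

/-- `JE α M i j` is the `(i,j)` entry (`0`-based) of the truncated Jacobi matrix
`J(α)_L^M` (of any size `L − M + 1`). -/
def JE (α : ℝ) (M : ℕ) (i j : ℕ) : ℝ :=
  if i + 1 = j then b α (M + i + 1) else if j + 1 = i then b α (M + j + 1) else 0

/-- The truncated Jacobi matrix `J(α)_{M+l}^M`, of size `(l+1) × (l+1)`.
In particular `Jt α 0 l` is the Jacobi matrix `J(α)_l`. -/
def Jt (α : ℝ) (M l : ℕ) : Matrix (Fin (l + 1)) (Fin (l + 1)) ℝ :=
  fun i j => JE α M i.1 j.1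

/-- The spherical harmonics `Y_l^k(θ, φ)`. -/
def Y (l : ℕ) (k : ℤ) (θ φ : ℝ) : ℂ :=
  ((Real.sin θ ^ k.natAbs : ℝ) : ℂ) * ((p (k.natAbs : ℝ) (l - k.natAbs) (Real.cos θ) : ℝ) : ℂ) *
    Complex.exp (Complex.I * (k : ℂ) * (φ : ℂ))

/-- Parameter region `[0, π] × [0, 2π]` of spherical coordinates. -/
def region : Set (ℝ × ℝ) := Set.Icc (0 : ℝ) Real.pi ×ˢ Set.Icc (0 : ℝ) (2 * Real.pi)

/-- The inner product of `L²(S²)`. -/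
def inner2 (f g : ℝ → ℝ → ℂ) : ℂ :=
  (1 / (4 * Real.pi)) *
    ∫ q in region, f q.1 q.2 * (starRingEnd ℂ) (g q.1 q.2) * ((Real.sin q.1 : ℝ) : ℂ)

/-- The norm of `L²(S²)`. -/
def norm2 (f : ℝ → ℝ → ℂ) : ℝ := Real.sqrt (inner2 f f).re

/-- Membership in `L²(S²)`. -/
def MemL2 (f : ℝ → ℝ → ℂ) : Prop :=
  Measurable (fun q : ℝ × ℝ => f q.1 q.2) ∧
    IntegrableOn (fun q : ℝ × ℝ => ‖f q.1 q.2‖ ^ 2 * Real.sin q.1) region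

/-- The multiplication operator `M`. -/
def Mop (f : ℝ → ℝ → ℂ) : ℝ → ℝ → ℂ := fun θ φ => ((Real.cos θ : ℝ) : ℂ) * f θ φ

/-- The power `M^j` of the multiplication operator. -/
def Mpow (j : ℕ) (f : ℝ → ℝ → ℂ) : ℝ → ℝ → ℂ := fun θ φ => ((Real.cos θ : ℝ) : ℂ) ^ j * f θ φ

/-- The mean value `ε(f)`. -/
def eps (f : ℝ → ℝ → ℂ) : ℝ :=
  (1 / (4 * Real.pi)) * ∫ q in region, Real.cos q.1 * ‖f q.1 q.2‖ ^ 2 * Real.sin q.1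

/-- The projection `P_n^m` onto `Π_n^m`. -/
def Pr (n m : ℕ) (f : ℝ → ℝ → ℂ) : ℝ → ℝ → ℂ :=
  fun θ φ => ∑ l ∈ Finset.Icc m n, ∑ k ∈ Finset.Icc (-(l : ℤ)) (l : ℤ),
    inner2 f (Y l k) * Y l k θ φ

/-- The space–frequency operator `P_n^m M P_n^m`. -/
def SFop (n m : ℕ) (f : ℝ → ℝ → ℂ) : ℝ → ℝ → ℂ := Pr n m (Mop (Pr n m f))

/-- The space `Π_n^m`, spanned by the spherical harmonics `Y_l^k`, `m ≤ l ≤ n`, `|k| ≤ l`. -/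
def Pi_nm (n m : ℕ) : Submodule ℂ (ℝ → ℝ → ℂ) :=
  Submodule.span ℂ {g | ∃ l : ℕ, ∃ k : ℤ, m ≤ l ∧ l ≤ n ∧ k.natAbs ≤ l ∧ g = Y l k}

/-- `N_k = n − max(|k|, m) + 1`. -/
def Nk (n m k : ℕ) : ℕ := n - max k m + 1

/-- The normalizing constant `κ_{k,i}`, given the corresponding root value `xr`. -/
def kap (n m k : ℕ) (xr : ℝ) : ℝ :=
  (Real.sqrt (∑ l ∈ Finset.Icc (max k m) n, (pA (k : ℝ) (m - k) (l - max k m) xr) ^ 2))⁻¹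

/-- The eigenfunction `ψ_{k,i}`, given the corresponding root value `xr`. -/
def psiFun (n m : ℕ) (k : ℤ) (xr : ℝ) : ℝ → ℝ → ℂ :=
  fun θ φ => ((kap n m k.natAbs xr : ℝ) : ℂ) *
    ∑ l ∈ Finset.Icc (max k.natAbs m) n,
      ((pA (k.natAbs : ℝ) (m - k.natAbs) (l - max k.natAbs m) xr : ℝ) : ℂ) * Y l k θ φ


lemma b_pos (α : ℝ) (hα : 0 ≤ α) (l : ℕ) : 0 < b α l := by
  cases l with
  | zero =>
    unfold b
    apply Real.sqrt_pos.mpr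
    have h1 := Real.Gamma_pos_of_pos (show 0 < α + 1 by linarith)
    have h2 := Real.Gamma_pos_of_pos (show 0 < α + 3 / 2 by linarith)
    have h3 := Real.sqrt_pos.mpr Real.pi_pos
    positivity
  | succ l =>
    unfold b
    apply Real.sqrt_pos.mpr
    have hl : (0 : ℝ) ≤ l := Nat.cast_nonneg l
    have h1 : 0 < 2 * ((l : ℝ) + 1) + 2 * α - 1 := by linarith
    positivity

lemma b_sq (α : ℝ) (hα : 0 ≤ α) (l : ℕ) :
    (2 * ((l : ℝ) + 1) + 2 * α + 1) * (2 * ((l : ℝ) + 1) + 2 * α - 1) * b α (l + 1) ^ 2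
      = ((l : ℝ) + 1) * (((l : ℝ) + 1) + 2 * α) := by
  have hl : (0 : ℝ) ≤ l := Nat.cast_nonneg l
  have h1 : 0 < 2 * ((l : ℝ) + 1) + 2 * α - 1 := by linarith
  have h2 : 0 < 2 * ((l : ℝ) + 1) + 2 * α + 1 := by linarith
  unfold b
  rw [Real.sq_sqrt (by positivity)]
  have h3 := (mul_pos h2 h1).ne'
  exact mul_div_cancel₀ _ h3

/-- `b_n p_{n-1}`, zero for `n = 0`. -/
def qf (α : ℝ) : ℕ → ℝ → ℝ
  | 0, _ => 0
  | l + 1, x => b α (l + 1) * p α l x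

lemma qf_succ (α : ℝ) (l : ℕ) (x : ℝ) : qf α (l + 1) x = b α (l + 1) * p α l x := rfl

lemma p_rec (α : ℝ) (hα : 0 ≤ α) (l : ℕ) (x : ℝ) :
    x * p α l x = b α (l + 1) * p α (l + 1) x + qf α l x := by
  have hb := (b_pos α hα (l + 1)).ne'
  cases l with
  | zero =>
    simp only [p, qf, pA]
    simp only [zero_add] at *
    field_simp
    ring
  | succ l =>
    simp only [p, qf]
    rw [show pA α 0 (l + 1 + 1) x = (x * pA α 0 (l + 1) x - b α (0 + l + 1) * pA α 0 l x) /
      b α (0 + l + 2) from rfl]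
    simp only [zero_add]
    rw [show l + 2 = l + 1 + 1 from rfl]
    field_simp
    ring

lemma p_deriv (α : ℝ) (hα : 0 ≤ α) (x : ℝ) (n : ℕ) :
    (∃ d, HasDerivAt (p α n) d x ∧
      (1 - x ^ 2) * d = -(n : ℝ) * x * p α n x + (2 * n + 2 * α + 1) * qf α n x) ∧
    (∃ d, HasDerivAt (p α (n + 1)) d x ∧
      (1 - x ^ 2) * d = -((n : ℝ) + 1) * x * p α (n + 1) x
        + (2 * (n + 1) + 2 * α + 1) * qf α (n + 1) x) := by
  induction n with
  | zero =>
    refine ⟨⟨0, ?_, ?_⟩, ⟨(1 / b α 0) / b α 1, ?_, ?_⟩⟩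
    · exact hasDerivAt_const x (1 / b α 0)
    · simp [qf]
    · have := ((hasDerivAt_id x).mul_const (1 / b α 0)).div_const (b α 1)
      have e : p α 1 = fun y => id y * (1 / b α 0) / b α 1 := by
        funext y; simp [p, pA]
      rw [e]
      simpa using this
    · have h0 := (b_pos α hα 0).ne'
      have h1 := (b_pos α hα 1).ne'
      have hs := b_sq α hα 0
      have hs' : (3 + 2 * α) * b α 1 ^ 2 = 1 := by
        have : (1 + 2 * α) * ((3 + 2 * α) * b α 1 ^ 2) = (1 + 2 * α) * 1 := by
          simp only [Nat.cast_zero, zero_add] at hs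
          linarith
        exact mul_left_cancel₀ (by linarith) this
      simp only [p, qf, pA, zero_add, Nat.cast_zero]
      field_simp
      linear_combination (-1) * hs'
  | succ n ih =>
    obtain ⟨⟨d0, hd0, e0⟩, ⟨d1, hd1, e1⟩⟩ := ih
    have hb := (b_pos α hα (n + 2)).ne'
    refine ⟨⟨d1, hd1, by push_cast; exact e1⟩, ?_⟩
    refine ⟨(p α (n + 1) x + x * d1 - b α (n + 1) * d0) / b α (n + 2), ?_, ?_⟩
    · have h := ((((hasDerivAt_id x).mul hd1)).sub (hd0.const_mul (b α (n + 1)))).div_const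
        (b α (n + 2))
      have e : p α (n + 1 + 1) = fun y =>
          ((id * p α (n + 1) - fun y => b α (n + 1) * p α n y : ℝ → ℝ)) y / b α (n + 2) := by
        funext y
        have := p_rec α hα (n + 1) y
        simp only [qf_succ] at this
        rw [show n + 1 + 1 = n + 2 from rfl] at this ⊢
        simp only [Pi.sub_apply, Pi.mul_apply, id]
        rw [eq_div_iff hb]
        linarith
      rw [e]
      simpa using h
    · have r0 := p_rec α hα n x
      have r1 := p_rec α hα (n + 1) x
      have s0 := b_sq α hα n
      have s1 := b_sq α hα (n + 1)
      rw [show n + 1 + 1 = n + 2 from rfl] at *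
      simp only [qf_succ] at *
      have hn : (0 : ℝ) ≤ n := Nat.cast_nonneg n
      push_cast at *
      have key : 1 + (2 * n + 2 * α + 1) * b α (n + 1) ^ 2
          = (2 * n + 2 * α + 5) * b α (n + 2) ^ 2 := by
        have : (2 * n + 2 * α + 3) * (1 + (2 * n + 2 * α + 1) * b α (n + 1) ^ 2)
            = (2 * n + 2 * α + 3) * ((2 * n + 2 * α + 5) * b α (n + 2) ^ 2) := by
          linear_combination s0 - s1
        exact mul_left_cancel₀ (by positivity) this
      rw [show (1 - x ^ 2) * ((p α (n + 1) x + x * d1 - b α (n + 1) * d0) / b α (n + 2))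
        = ((1 - x ^ 2) * p α (n + 1) x + x * ((1 - x ^ 2) * d1)
          - b α (n + 1) * ((1 - x ^ 2) * d0)) / b α (n + 2) by ring, e0, e1, div_eq_iff hb]
      have q0 : qf α n x = x * p α n x - b α (n + 1) * p α (n + 1) x := by linarith
      rw [q0]
      linear_combination (p α (n + 1) x) * key - (n + 2) * x * r1

lemma p_cont (α : ℝ) (hα : 0 ≤ α) (n : ℕ) : Continuous (p α n) :=
  continuous_iff_continuousAt.mpr fun x =>
    ((p_deriv α hα x n).1.choose_spec.1).continuousAt

/-- The weighted integral. -/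
def LL (K : ℕ) (f : ℝ → ℝ) : ℝ :=
  (1 / 2) * ∫ θ in (0 : ℝ)..Real.pi, Real.sin θ ^ (2 * K + 1) * f (Real.cos θ)

lemma LL_add (K : ℕ) (f g : ℝ → ℝ) (hf : Continuous f) (hg : Continuous g) :
    LL K (fun x => f x + g x) = LL K f + LL K g := by
  unfold LL
  rw [← mul_add, ← intervalIntegral.integral_add]
  · simp only [mul_add]
  · apply Continuous.intervalIntegrable; fun_prop
  · apply Continuous.intervalIntegrable; fun_prop

lemma LL_smul (K : ℕ) (c : ℝ) (f : ℝ → ℝ) :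
    LL K (fun x => c * f x) = c * LL K f := by
  unfold LL
  rw [mul_left_comm c]
  congr 1
  rw [← intervalIntegral.integral_const_mul]
  congr 1
  funext θ
  ring

lemma LL_sum (K : ℕ) (s : Finset ℕ) (f : ℕ → ℝ → ℝ) (hf : ∀ i, Continuous (f i)) :
    LL K (fun x => ∑ i ∈ s, f i x) = ∑ i ∈ s, LL K (f i) := by
  classical
  induction s using Finset.induction_on with
  | empty => simp [LL]
  | insert a s ha ih =>
    simp only [Finset.sum_insert ha]
    rw [LL_add K (f a) (fun x => ∑ i ∈ s, f i x) (hf a) (by fun_prop), ih]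

lemma LL_parts (K n : ℕ) :
    (n + 2 * K + 2) * LL K (fun x => x * p K n x)
      = (2 * n + 2 * K + 1) * LL K (qf K n) := by
  have hK : (0 : ℝ) ≤ K := Nat.cast_nonneg K
  have hp := p_cont K hK n
  have hq : Continuous (qf K n) := by
    cases n with
    | zero => exact continuous_const
    | succ n => exact continuous_const.mul (p_cont K hK n)
  have h : ∀ θ : ℝ, HasDerivAt (fun θ => Real.sin θ ^ (2 * K + 2) * p K n (Real.cos θ))
      (Real.sin θ ^ (2 * K + 1) * ((n + 2 * K + 2) * (Real.cos θ * p K n (Real.cos θ))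
        + (-(2 * n + 2 * K + 1)) * qf K n (Real.cos θ))) θ := by
    intro θ
    obtain ⟨d, hd, e⟩ := (p_deriv K hK (Real.cos θ) n).1
    have h1 := ((Real.hasDerivAt_sin θ).pow (2 * K + 2)).mul (hd.comp θ (Real.hasDerivAt_cos θ))
    refine HasDerivAt.congr_deriv h1 ?_
    have e' : Real.sin θ ^ 2 * d = -(n : ℝ) * Real.cos θ * p K n (Real.cos θ)
        + (2 * n + 2 * K + 1) * qf K n (Real.cos θ) := by
      rw [Real.sin_sq]; exact e
    simp only [Function.comp, Pi.pow_apply]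
    rw [show 2 * K + 2 - 1 = 2 * K + 1 from rfl]
    push_cast
    linear_combination (-(Real.sin θ ^ (2 * K + 1))) * e'
  have hint := intervalIntegral.integral_eq_sub_of_hasDerivAt (a := 0) (b := Real.pi)
    (fun θ _ => h θ) (by apply Continuous.intervalIntegrable; fun_prop)
  simp only [Real.sin_pi, Real.sin_zero] at hint
  have hz : LL K (fun x => (n + 2 * K + 2) * (x * p K n x) + (-(2 * n + 2 * K + 1)) * qf K n x)
      = 0 := by
    unfold LL
    rw [hint]; simp
  rw [LL_add K _ _ (by fun_prop) (by fun_prop), LL_smul, LL_smul] at hz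
  linarith

lemma LL_one (K : ℕ) : LL K (fun _ => 1) = b K 0 ^ 2 := by
  have h1 := Real.Gamma_pos_of_pos (show (0 : ℝ) < (K : ℝ) + 1 by positivity)
  have h2 := Real.Gamma_pos_of_pos (show (0 : ℝ) < (K : ℝ) + 3 / 2 by positivity)
  have h3 := Real.sqrt_pos.mpr Real.pi_pos
  unfold b
  rw [Real.sq_sqrt (by positivity)]
  unfold LL
  simp only [mul_one]
  clear h1 h2
  induction K with
  | zero =>
    have : Real.Gamma (3 / 2) = 1 / 2 * Real.sqrt Real.pi := by
      rw [show (3 / 2 : ℝ) = 1 / 2 + 1 by norm_num, Real.Gamma_add_one (by norm_num),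
        Real.Gamma_one_half_eq]
    simp [this]
    field_simp
    norm_num
  | succ K ih =>
    have h1 := Real.Gamma_pos_of_pos (show (0 : ℝ) < (K : ℝ) + 1 by positivity)
    have h2 := Real.Gamma_pos_of_pos (show (0 : ℝ) < (K : ℝ) + 3 / 2 by positivity)
    rw [integral_sin_pow_odd] at ih ⊢
    rw [Finset.prod_range_succ]
    push_cast
    rw [Real.Gamma_add_one (s := (K : ℝ) + 1) (by positivity),
      show (K : ℝ) + 1 + 3 / 2 = (K + 3 / 2) + 1 by ring,
      Real.Gamma_add_one (s := (K : ℝ) + 3 / 2) (by positivity)]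
    rw [← mul_assoc, ← mul_assoc] at *
    rw [ih]
    field_simp

lemma LL_p (K n : ℕ) : LL K (p K n) = if n = 0 then b K 0 else 0 := by
  have hK : (0 : ℝ) ≤ K := Nat.cast_nonneg K
  have main : ∀ n, (LL K (p K n) = if n = 0 then b K 0 else 0) ∧ LL K (p K (n + 1)) = 0 := by
    intro n
    have step : ∀ n, LL K (fun x => x * p K n x)
        = b K (n + 1) * LL K (p K (n + 1)) + LL K (qf K n) := by
      intro n
      have hp := p_cont K hK (n + 1)
      have hq : Continuous (qf K n) := by
        cases n with
        | zero => exact continuous_const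
        | succ n => exact continuous_const.mul (p_cont K hK n)
      rw [← LL_smul, ← LL_add K _ _ (by fun_prop) (by fun_prop)]
      congr 1
      funext x
      exact p_rec K hK n x
    induction n with
    | zero =>
      have hb0 := b_pos K hK 0
      have hb := b_pos K hK 1
      constructor
      · have : p (K : ℝ) 0 = fun _ => (1 / b K 0) * 1 := by funext x; simp [p, pA]
        rw [this, LL_smul, LL_one]
        simp
        field_simp
      · have h1 := LL_parts K 0
        have h2 : LL K (qf K 0) = 0 := by simp [LL, qf]
        rw [step 0, h2] at h1
        have : ((0 : ℕ) + 2 * K + 2 : ℝ) * b K (0 + 1) ≠ 0 := by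
          have : (0 : ℝ) < ((0 : ℕ) + 2 * K + 2 : ℝ) := by positivity
          exact mul_ne_zero this.ne' hb.ne'
        apply mul_left_cancel₀ this
        linarith
    | succ n ih =>
      refine ⟨by rw [ih.2]; simp, ?_⟩
      have hb := b_pos K hK (n + 1 + 1)
      have h1 := LL_parts K (n + 1)
      have h2 : LL K (qf K (n + 1)) = b K (n + 1) * LL K (p K n) := by
        rw [← LL_smul]; rfl
      rw [step (n + 1), h2, ih.1] at h1
      have : (((n + 1 : ℕ) : ℝ) + 2 * K + 2 : ℝ) * b K (n + 1 + 1) ≠ 0 := by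
        have : (0 : ℝ) < (((n + 1 : ℕ) : ℝ) + 2 * K + 2 : ℝ) := by positivity
        exact mul_ne_zero this.ne' hb.ne'
      apply mul_left_cancel₀ this
      by_cases hn : n = 0
      · subst hn
        simp only [if_true] at h1
        push_cast at *
        linarith
      · simp only [hn, if_false] at h1
        linarith
  exact (main n).1

lemma LL_orth (K i j : ℕ) : LL K (fun x => p K i x * p K j x) = if i = j then 1 else 0 := by
  have hK : (0 : ℝ) ≤ K := Nat.cast_nonneg K
  have hp := p_cont K hK
  have hq : ∀ n, Continuous (qf K n) := by
    intro n
    cases n with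
    | zero => exact continuous_const
    | succ n => exact continuous_const.mul (p_cont K hK n)
  have hx : ∀ i j, LL K (fun x => (x * p K i x) * p K j x)
      = b K (i + 1) * LL K (fun x => p K (i + 1) x * p K j x)
        + LL K (fun x => qf K i x * p K j x) := by
    intro i j
    have := hp (i + 1)
    have := hp j
    have := hq i
    rw [← LL_smul, ← LL_add K _ _ (by fun_prop) (by fun_prop)]
    congr 1
    funext x
    rw [p_rec K hK i x]; ring
  have hsym : ∀ i j, LL K (fun x => p K i x * p K j x) = LL K (fun x => p K j x * p K i x) := by
    intro i j; congr 1; funext x; ring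
  have hx' : ∀ i j, LL K (fun x => (x * p K i x) * p K j x)
      = LL K (fun x => (x * p K j x) * p K i x) := by
    intro i j; congr 1; funext x; ring
  have hq0 : ∀ j, LL K (fun x => qf K 0 x * p K j x) = 0 := by intro j; simp [LL, qf]
  have hq1 : ∀ i j, LL K (fun x => qf K (i + 1) x * p K j x)
      = b K (i + 1) * LL K (fun x => p K i x * p K j x) := by
    intro i j
    rw [← LL_smul]
    congr 1; funext x; simp only [qf]; ring
  have main : ∀ j, (∀ i, LL K (fun x => p K i x * p K j x) = if i = j then 1 else 0) ∧
      (∀ i, LL K (fun x => p K i x * p K (j + 1) x) = if i = j + 1 then 1 else 0) := by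
    have base : ∀ i, LL K (fun x => p K i x * p K 0 x) = if i = 0 then 1 else 0 := by
      intro i
      have hb0 := b_pos K hK 0
      have : (fun x => p (K : ℝ) i x * p K 0 x) = fun x => (1 / b K 0) * p K i x := by
        funext x; simp [p, pA]; ring
      rw [this, LL_smul, LL_p]
      split_ifs
      · field_simp
      · simp
    have step : ∀ j, (∀ i, LL K (fun x => p K i x * p K j x) = if i = j then 1 else 0) →
        (∀ i, LL K (fun x => qf K j x * p K i x) = if i + 1 = j then b K j else 0) →
        (∀ i, LL K (fun x => p K i x * p K (j + 1) x) = if i = j + 1 then 1 else 0) := by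
      intro j h1 h2 i
      have hb := b_pos K hK (j + 1)
      have e := hx' i j
      rw [hx i j, hx j i, h1, h2, hsym (j + 1) i] at e
      apply mul_left_cancel₀ hb.ne'
      cases i with
      | zero =>
        rw [hq0] at e
        rw [if_neg (by omega)]
        by_cases hj : 1 = j
        · subst hj; simp only [zero_add, if_true] at e ⊢; linarith
        · have : ¬ (0 + 1 = j) := by omega
          simp only [this, if_false] at e
          linarith
      | succ i =>
        rw [hq1, h1] at e
        by_cases hA : i = j
        · subst hA
          have c1 : ¬ (i + 1 + 1 = i) := by omega
          simp only [c1, if_false, if_true] at e ⊢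
          linarith
        · by_cases hB : i + 1 + 1 = j
          · subst hB
            have c2 : ¬ (i + 1 = i + 1 + 1 + 1) := by omega
            simp only [c2, if_false, if_true, hA] at e ⊢
            linarith
          · have c2 : ¬ (i + 1 = j + 1) := by omega
            simp only [c2, if_false, hA, hB] at e ⊢
            linarith
    intro j
    induction j with
    | zero => exact ⟨base, step 0 base (fun i => by rw [hq0]; simp)⟩
    | succ j ih =>
      refine ⟨ih.2, step (j + 1) ih.2 ?_⟩
      intro i
      rw [hq1, hsym, ih.1]
      by_cases hA : i = j
      · simp [hA]
      · simp [hA]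
  exact (main j).1 i

lemma CD (α : ℝ) (hα : 0 ≤ α) (x y : ℝ) (N : ℕ) :
    (x - y) * ∑ j ∈ Finset.range N, p α j y * p α j x
      = qf α N y * p α N x - qf α N x * p α N y := by
  induction N with
  | zero => simp [qf]
  | succ N ih =>
    rw [Finset.sum_range_succ, mul_add, ih]
    have r1 := p_rec α hα N x
    have r2 := p_rec α hα N y
    simp only [qf_succ]
    linear_combination (p α N y) * r1 - (p α N x) * r2

/-- Functions of the form `sin^|k| θ f(cos θ) e^{ikφ}`. -/
def FF (f : ℝ → ℝ) (k : ℤ) : ℝ → ℝ → ℂ := fun θ φ =>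
  ((Real.sin θ ^ k.natAbs : ℝ) : ℂ) * ((f (Real.cos θ) : ℝ) : ℂ) *
    Complex.exp (Complex.I * (k : ℂ) * (φ : ℂ))

lemma phi_int (k k' : ℤ) : ∫ φ in Set.Icc (0 : ℝ) (2 * Real.pi),
    Complex.exp (Complex.I * (k : ℂ) * (φ : ℂ)) *
      (starRingEnd ℂ) (Complex.exp (Complex.I * (k' : ℂ) * (φ : ℂ)))
    = if k = k' then ((2 * Real.pi : ℝ) : ℂ) else 0 := by
  have h : ∀ φ : ℝ, Complex.exp (Complex.I * (k : ℂ) * (φ : ℂ)) *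
      (starRingEnd ℂ) (Complex.exp (Complex.I * (k' : ℂ) * (φ : ℂ)))
      = Complex.exp ((Complex.I * ((k : ℂ) - k')) * (φ : ℂ)) := by
    intro φ
    rw [← Complex.exp_conj, ← Complex.exp_add]
    congr 1
    simp
    ring
  simp only [h]
  rw [MeasureTheory.integral_Icc_eq_integral_Ioc,
    ← intervalIntegral.integral_of_le (by positivity)]
  split_ifs with hk
  · subst hk
    simp
  · have hne : Complex.I * ((k : ℂ) - k') ≠ 0 := by
      apply mul_ne_zero Complex.I_ne_zero
      rw [sub_ne_zero]
      exact_mod_cast hk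
    rw [integral_exp_mul_complex hne]
    have : Complex.exp (Complex.I * ((k : ℂ) - k') * ((2 * Real.pi : ℝ) : ℂ)) = 1 := by
      rw [Complex.exp_eq_one_iff]
      refine ⟨k - k', ?_⟩
      push_cast
      ring
    rw [this]
    simp

lemma inner_FF (f g : ℝ → ℝ) (k k' : ℤ) :
    inner2 (FF f k) (FF g k')
      = if k = k' then ((LL k.natAbs (fun x => f x * g x) : ℝ) : ℂ) else 0 := by
  unfold inner2 region
  have h : ∀ q : ℝ × ℝ, FF f k q.1 q.2 * (starRingEnd ℂ) (FF g k' q.1 q.2) *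
      ((Real.sin q.1 : ℝ) : ℂ)
      = ((Real.sin q.1 ^ (k.natAbs + k'.natAbs + 1) * (f (Real.cos q.1) * g (Real.cos q.1)) : ℝ) : ℂ)
        * (Complex.exp (Complex.I * (k : ℂ) * (q.2 : ℂ)) *
      (starRingEnd ℂ) (Complex.exp (Complex.I * (k' : ℂ) * (q.2 : ℂ)))) := by
    intro q
    simp only [FF, map_mul, Complex.conj_ofReal]
    push_cast
    ring
  simp only [h]
  rw [MeasureTheory.Measure.volume_eq_prod]
  rw [MeasureTheory.setIntegral_prod_mul
    (fun θ : ℝ => ((Real.sin θ ^ (k.natAbs + k'.natAbs + 1) *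
      (f (Real.cos θ) * g (Real.cos θ)) : ℝ) : ℂ))
    (fun φ : ℝ => Complex.exp (Complex.I * (k : ℂ) * (φ : ℂ)) *
      (starRingEnd ℂ) (Complex.exp (Complex.I * (k' : ℂ) * (φ : ℂ))))]
  rw [phi_int]
  split_ifs with hk
  · subst hk
    rw [integral_complex_ofReal, MeasureTheory.integral_Icc_eq_integral_Ioc,
      ← intervalIntegral.integral_of_le Real.pi_pos.le]
    unfold LL
    rw [← two_mul]
    have := Real.pi_pos.ne'
    have h2 : ((Real.pi : ℝ) : ℂ) ≠ 0 := by exact_mod_cast this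
    push_cast
    field_simp
    ring
  · simp

lemma Y_eq (l : ℕ) (k : ℤ) : Y l k = FF (p (k.natAbs : ℝ) (l - k.natAbs)) k := rfl

lemma sum_shift {M : Type*} [AddCommMonoid M] (K n : ℕ) (h : K ≤ n) (f : ℕ → M) :
    ∑ l ∈ Finset.Icc K n, f (l - K) = ∑ j ∈ Finset.range (n - K + 1), f j := by
  refine Finset.sum_nbij' (fun l => l - K) (fun j => j + K) ?_ ?_ ?_ ?_ ?_
  · intro l hl; simp only [Finset.mem_Icc, Finset.mem_range] at *; omega
  · intro l hl; simp only [Finset.mem_Icc, Finset.mem_range] at *; omega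
  · intro l hl; simp only [Finset.mem_Icc] at *; omega
  · intro l hl; simp
  · intro l hl; rfl

lemma Pr_FF (n m : ℕ) (k : ℤ) (hk1 : m + 1 ≤ k.natAbs) (hk2 : k.natAbs ≤ n) (f : ℝ → ℝ) :
    Pr n m (FF f k) = FF (fun x => ∑ j ∈ Finset.range (n - k.natAbs + 1),
      LL k.natAbs (fun x => f x * p (k.natAbs : ℝ) j x) * p (k.natAbs : ℝ) j x) k := by
  funext θ φ
  unfold Pr
  simp only [Y_eq, inner_FF]
  have h1 : ∀ l : ℕ, ∑ k' ∈ Finset.Icc (-(l : ℤ)) (l : ℤ),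
      (if k = k' then ((LL k.natAbs (fun x => f x * p (k'.natAbs : ℝ) (l - k'.natAbs) x) : ℝ) : ℂ)
        else 0) * FF (p (k'.natAbs : ℝ) (l - k'.natAbs)) k' θ φ
      = if k.natAbs ≤ l then
        ((LL k.natAbs (fun x => f x * p (k.natAbs : ℝ) (l - k.natAbs) x) : ℝ) : ℂ)
          * FF (p (k.natAbs : ℝ) (l - k.natAbs)) k θ φ else 0 := by
    intro l
    simp only [ite_mul, zero_mul]
    rw [Finset.sum_ite_eq]
    refine if_congr ?_ rfl rfl
    rw [Finset.mem_Icc]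
    omega
  simp only [h1]
  rw [← Finset.sum_filter]
  have h2 : (Finset.Icc m n).filter (fun l => k.natAbs ≤ l) = Finset.Icc k.natAbs n := by
    ext l
    simp only [Finset.mem_filter, Finset.mem_Icc]
    omega
  rw [h2, sum_shift k.natAbs n hk2 (fun j =>
    ((LL k.natAbs (fun x => f x * p (k.natAbs : ℝ) j x) : ℝ) : ℂ)
          * FF (p (k.natAbs : ℝ) j) k θ φ)]
  simp only [FF]
  push_cast
  rw [Finset.mul_sum, Finset.sum_mul]
  refine Finset.sum_congr rfl fun j _ => ?_
  ring

lemma psi_eq (n m : ℕ) (k : ℤ) (hk1 : m + 1 ≤ k.natAbs) (hk2 : k.natAbs ≤ n) (xr : ℝ) :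
    psiFun n m k xr = FF (fun x => kap n m k.natAbs xr *
      ∑ j ∈ Finset.range (n - k.natAbs + 1), p (k.natAbs : ℝ) j xr * p (k.natAbs : ℝ) j x) k := by
  funext θ φ
  unfold psiFun
  rw [max_eq_left (by omega), show m - k.natAbs = 0 by omega]
  simp only [Y_eq]
  rw [sum_shift k.natAbs n hk2 (fun j =>
    ((pA (k.natAbs : ℝ) 0 j xr : ℝ) : ℂ) * FF (p (k.natAbs : ℝ) j) k θ φ)]
  simp only [FF]
  push_cast
  rw [Finset.mul_sum, Finset.mul_sum, Finset.mul_sum, Finset.sum_mul]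
  refine Finset.sum_congr rfl fun j _ => ?_
  simp only [p]
  ring

lemma kap_eq (n m K : ℕ) (hk1 : m + 1 ≤ K) (hk2 : K ≤ n) (xr : ℝ) :
    kap n m K xr = (Real.sqrt (∑ j ∈ Finset.range (n - K + 1), p K j xr ^ 2))⁻¹ := by
  unfold kap
  rw [max_eq_left (by omega), show m - K = 0 by omega,
    sum_shift K n hk2 (fun j => pA K 0 j xr ^ 2)]
  rfl

lemma LL_expand (K N : ℕ) (c : ℝ) (a : ℕ → ℝ) (j : ℕ) :
    LL K (fun x => (c * ∑ i ∈ Finset.range N, a i * p K i x) * p K j x)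
      = if j < N then c * a j else 0 := by
  have hK : (0 : ℝ) ≤ K := Nat.cast_nonneg K
  have hp := p_cont K hK
  have : (fun x => (c * ∑ i ∈ Finset.range N, a i * p K i x) * p K j x)
      = fun x => ∑ i ∈ Finset.range N, (c * a i) * (p K i x * p K j x) := by
    funext x
    rw [Finset.mul_sum, Finset.sum_mul]
    refine Finset.sum_congr rfl fun i _ => ?_
    ring
  rw [this, LL_sum K _ (fun i x => (c * a i) * (p K i x * p K j x))
    (fun i => by have := hp i; have := hp j; fun_prop)]
  simp only [LL_smul, LL_orth, mul_ite, mul_one, mul_zero]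
  rw [Finset.sum_ite_eq']
  simp

/-- for `m+1 ≤ |k| ≤ n` and any root `xr` of `p_{n−|k|+1}^{(|k|)}`, the function
`ψ_{k,i}` lies in `Π_n^m`, has unit norm, is an eigenfunction of `P_n^m M P_n^m` with
eigenvalue `xr`, and has the stated closed form wherever `cos θ ≠ xr`. -/
theorem stmt8 (n m : ℕ) (hmn : m ≤ n) (k : ℤ) (hk1 : m + 1 ≤ k.natAbs) (hk2 : k.natAbs ≤ n)
    (xr : ℝ) (hroot : p (k.natAbs : ℝ) (n - k.natAbs + 1) xr = 0) :
    psiFun n m k xr ∈ Pi_nm n m ∧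
    norm2 (psiFun n m k xr) = 1 ∧
    SFop n m (psiFun n m k xr) = (fun θ φ => ((xr : ℝ) : ℂ) * psiFun n m k xr θ φ) ∧
    (∀ θ φ : ℝ, Real.cos θ ≠ xr →
      psiFun n m k xr θ φ =
        ((kap n m k.natAbs xr : ℝ) : ℂ) *
          (((b (k.natAbs : ℝ) (n - k.natAbs + 1) *
              p (k.natAbs : ℝ) (n - k.natAbs) xr : ℝ) : ℂ)) *
          ((Real.sin θ ^ k.natAbs : ℝ) : ℂ) *
          ((p (k.natAbs : ℝ) (n - k.natAbs + 1) (Real.cos θ) : ℝ) : ℂ) *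
          Complex.exp (Complex.I * (k : ℂ) * (φ : ℂ)) /
          (((Real.cos θ : ℝ) : ℂ) - ((xr : ℝ) : ℂ))) := by
  have hK : (0 : ℝ) ≤ (k.natAbs : ℝ) := Nat.cast_nonneg _
  have hpc := p_cont (k.natAbs : ℝ) hK
  have hpsi := psi_eq n m k hk1 hk2 xr
  have hkap := kap_eq n m k.natAbs hk1 hk2 xr
  have hCD : ∀ x, (x - xr) * ∑ j ∈ Finset.range (n - k.natAbs + 1),
      p (k.natAbs : ℝ) j xr * p (k.natAbs : ℝ) j x
      = b (k.natAbs : ℝ) (n - k.natAbs + 1) * p (k.natAbs : ℝ) (n - k.natAbs) xr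
        * p (k.natAbs : ℝ) (n - k.natAbs + 1) x := by
    intro x
    have := CD (k.natAbs : ℝ) hK x xr (n - k.natAbs + 1)
    rw [hroot] at this
    simpa [qf] using this
  refine ⟨?_, ?_, ?_, ?_⟩
  · have : psiFun n m k xr = ((kap n m k.natAbs xr : ℝ) : ℂ) •
        ∑ l ∈ Finset.Icc (max k.natAbs m) n,
          ((pA (k.natAbs : ℝ) (m - k.natAbs) (l - max k.natAbs m) xr : ℝ) : ℂ) • Y l k := by
      funext θ φ
      simp [psiFun, Finset.sum_apply]
    rw [this]
    refine Submodule.smul_mem _ _ (Submodule.sum_mem _ fun l hl => Submodule.smul_mem _ _ ?_)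
    rw [Finset.mem_Icc] at hl
    exact Submodule.subset_span ⟨l, k, by omega, by omega, by omega, rfl⟩
  · rw [hpsi]
    unfold norm2
    rw [inner_FF, if_pos rfl, Complex.ofReal_re, Real.sqrt_eq_one]
    set κ := kap n m k.natAbs xr with hκ
    set S := ∑ j ∈ Finset.range (n - k.natAbs + 1), p (k.natAbs : ℝ) j xr ^ 2 with hS
    have hSpos : 0 < S := by
      have h0 : p (k.natAbs : ℝ) 0 xr ≠ 0 := by
        have := b_pos (k.natAbs : ℝ) hK 0
        simp only [p, pA]
        positivity
      have h1 : p (k.natAbs : ℝ) 0 xr ^ 2 ≤ S :=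
        Finset.single_le_sum (f := fun j => p (k.natAbs : ℝ) j xr ^ 2)
          (fun i _ => sq_nonneg _) (Finset.mem_range.mpr (by omega))
      have : 0 < p (k.natAbs : ℝ) 0 xr ^ 2 := by positivity
      linarith
    have e : (fun x => (κ * ∑ j ∈ Finset.range (n - k.natAbs + 1),
          p (k.natAbs : ℝ) j xr * p (k.natAbs : ℝ) j x) *
        (κ * ∑ j ∈ Finset.range (n - k.natAbs + 1),
          p (k.natAbs : ℝ) j xr * p (k.natAbs : ℝ) j x))
        = fun x => ∑ i ∈ Finset.range (n - k.natAbs + 1), (κ * p (k.natAbs : ℝ) i xr) *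
          ((κ * ∑ j ∈ Finset.range (n - k.natAbs + 1),
          p (k.natAbs : ℝ) j xr * p (k.natAbs : ℝ) j x) * p (k.natAbs : ℝ) i x) := by
      funext x
      conv_lhs => rw [mul_comm]
      conv_lhs => enter [1]; rw [Finset.mul_sum]
      rw [Finset.sum_mul]
      refine Finset.sum_congr rfl fun i _ => ?_
      ring
    rw [e, LL_sum k.natAbs _ (fun i x => (κ * p (k.natAbs : ℝ) i xr) *
          ((κ * ∑ j ∈ Finset.range (n - k.natAbs + 1),
          p (k.natAbs : ℝ) j xr * p (k.natAbs : ℝ) j x) * p (k.natAbs : ℝ) i x))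
      (fun i => by fun_prop)]
    simp only [LL_smul]
    have e2 : ∑ i ∈ Finset.range (n - k.natAbs + 1), (κ * p (k.natAbs : ℝ) i xr) *
        LL k.natAbs (fun x => (κ * ∑ j ∈ Finset.range (n - k.natAbs + 1),
          p (k.natAbs : ℝ) j xr * p (k.natAbs : ℝ) j x) * p (k.natAbs : ℝ) i x)
        = κ ^ 2 * S := by
      rw [hS, Finset.mul_sum]
      refine Finset.sum_congr rfl fun i hi => ?_
      rw [LL_expand k.natAbs (n - k.natAbs + 1) κ (fun j => p (k.natAbs : ℝ) j xr) i,
        if_pos (Finset.mem_range.mp hi)]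
      ring
    rw [e2, hkap, inv_pow, Real.sq_sqrt hSpos.le]
    exact inv_mul_cancel₀ hSpos.ne'
  · rw [hpsi]
    unfold SFop
    set κ := kap n m k.natAbs xr with hκ
    set g : ℝ → ℝ := fun x => κ * ∑ j ∈ Finset.range (n - k.natAbs + 1),
      p (k.natAbs : ℝ) j xr * p (k.natAbs : ℝ) j x with hg
    have hgc : Continuous g := by rw [hg]; fun_prop
    have hLg : ∀ j, LL k.natAbs (fun x => g x * p (k.natAbs : ℝ) j x)
        = if j < n - k.natAbs + 1 then κ * p (k.natAbs : ℝ) j xr else 0 := fun j =>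
      LL_expand k.natAbs (n - k.natAbs + 1) κ (fun j => p (k.natAbs : ℝ) j xr) j
    have hP1 : Pr n m (FF g k) = FF g k := by
      rw [Pr_FF n m k hk1 hk2]
      congr 1
      funext x
      simp only [hLg]
      rw [hg]
      simp only
      rw [Finset.mul_sum]
      refine Finset.sum_congr rfl fun i hi => ?_
      rw [if_pos (Finset.mem_range.mp hi)]
      ring
    have hM : Mop (FF g k) = FF (fun x => x * g x) k := by
      funext θ φ
      simp only [Mop, FF]
      push_cast
      ring
    rw [hP1, hM, Pr_FF n m k hk1 hk2]
    have hLx : ∀ j ∈ Finset.range (n - k.natAbs + 1),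
        LL k.natAbs (fun x => x * g x * p (k.natAbs : ℝ) j x)
        = xr * (κ * p (k.natAbs : ℝ) j xr) := by
      intro j hj
      rw [Finset.mem_range] at hj
      have hfun : (fun x => x * g x * p (k.natAbs : ℝ) j x) = fun x =>
          xr * (g x * p (k.natAbs : ℝ) j x) +
          (κ * (b (k.natAbs : ℝ) (n - k.natAbs + 1) * p (k.natAbs : ℝ) (n - k.natAbs) xr)) *
            (p (k.natAbs : ℝ) (n - k.natAbs + 1) x * p (k.natAbs : ℝ) j x) := by
        funext x
        have := hCD x
        rw [hg]
        simp only
        linear_combination (κ * p (k.natAbs : ℝ) j x) * this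
      rw [hfun, LL_add k.natAbs _ _ (by fun_prop) (by fun_prop), LL_smul, LL_smul, LL_orth,
        hLg, if_pos hj, if_neg (by omega)]
      ring
    funext θ φ
    have : (fun x => ∑ j ∈ Finset.range (n - k.natAbs + 1),
        LL k.natAbs (fun x => x * g x * p (k.natAbs : ℝ) j x) * p (k.natAbs : ℝ) j x)
        = fun x => xr * g x := by
      funext x
      rw [hg]
      simp only
      rw [Finset.mul_sum, Finset.mul_sum]
      refine Finset.sum_congr rfl fun i hi => ?_
      have := hLx i hi
      rw [hg] at this
      rw [this]
      ring
    rw [this]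
    simp only [FF]
    push_cast
    ring
  · intro θ φ hne
    rw [hpsi]
    have h1 : ((Real.cos θ : ℝ) : ℂ) - ((xr : ℝ) : ℂ) ≠ 0 := by
      rw [sub_ne_zero]
      exact_mod_cast hne
    rw [eq_div_iff h1]
    have := hCD (Real.cos θ)
    have h2 := congrArg (fun t : ℝ => (t : ℂ)) this
    simp only [FF]
    push_cast at h2 ⊢
    linear_combination ((kap n m k.natAbs xr : ℝ) : ℂ) * (Complex.sin θ) ^ k.natAbs
      * Complex.exp (Complex.I * (k : ℂ) * (φ : ℂ)) * h2
end SFT
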